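/- Let a, b, c, μ ∈ ℂ with Re(a-c-μ+1) > 0, Re(b-c-μ+1) > 0 and Re(c-a-b+1) > 0, and assume that neither c-a-b+1 nor 2-c-μ is a nonpositive integer. Then for every real x ∈ (0,1), ∫_{1}^{∞} y^{c-1} (y-1)^{c-a-b} F(c-a, c-b; c-a-b+1; 1-y) (y-x)^{μ-1} dy = (Γ(a-c-μ+1)Γ(b-c-μ+1)Γ(c-a-b+1)/(Γ(2-c-μ)Γ(1-μ))) · x^{c+μ-1} · x^{1-c-μ} F(a-c-μ+1, b-c-μ+1; 2-c-μ; x) = (Γ(a-c-μ+1)Γ(b-c-μ+1)Γ(c-a-b+1)/(Γ(2-c-μ)Γ(1-μ))) · F(a-c-μ+1, b-c-μ+1; 2-c-μ; x) (a generalized Stieltjes transform of type c+ sending the solution w₆ to the solution w₂ of the hypergeometric differential equation). -/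

import Mathlib

open MeasureTheory Set Complex Filter

/-- Pochhammer symbol `(a)_k = a (a+1) ⋯ (a+k-1)`. -/
noncomputable def poch (a : ℂ) (k : ℕ) : ℂ := ∏ i ∈ Finset.range k, (a + i)

/-- The Gauss hypergeometric function `F(a,b;c;x)` for real `x < 1`, defined by the
power series on `[0,1)` and by the (agreeing) Pfaff series for `x < 0`. -/
noncomputable def hypF (a b c : ℂ) (x : ℝ) : ℂ :=
  if 0 ≤ x then
    ∑' k : ℕ, poch a k * poch b k / (poch c k * (Nat.factorial k : ℂ)) * (x : ℂ) ^ k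
  else
    ((1 - x : ℝ) : ℂ) ^ (-a) *
      ∑' k : ℕ, poch a k * poch (c - b) k / (poch c k * (Nat.factorial k : ℂ)) *
        (((x / (x - 1) : ℝ)) : ℂ) ^ k

lemma poch_succ (a : ℂ) (k : ℕ) : poch a (k + 1) = poch a k * (a + k) := by
  simp [poch, Finset.prod_range_succ]

lemma poch_zero (a : ℂ) : poch a 0 = 1 := by simp [poch]

lemma poch_ne_zero {c : ℂ} (hc : ∀ n : ℕ, c ≠ -(n : ℂ)) (k : ℕ) : poch c k ≠ 0 := by
  rw [poch, Finset.prod_ne_zero_iff]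
  intro i _ h
  exact hc i (eq_neg_of_add_eq_zero_left h)

lemma ne_neg_of_re_pos {c : ℂ} (hc : 0 < c.re) (n : ℕ) : c ≠ -(n : ℂ) := by
  rintro rfl
  simp at hc
  have : (0:ℝ) ≤ n := n.cast_nonneg
  linarith

lemma gammaSeq_eq (a : ℂ) (n : ℕ) :
    GammaSeq a n = (n : ℂ) ^ a * (Nat.factorial n : ℂ) / poch a (n + 1) := by
  simp [GammaSeq, poch]

lemma poch_neg_eventually (m : ℕ) : ∀ᶠ n : ℕ in atTop, poch (-(m : ℂ)) n = 0 := by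
  filter_upwards [eventually_gt_atTop m] with n hn
  rw [poch, Finset.prod_eq_zero_iff]
  exact ⟨m, Finset.mem_range.2 hn, by simp⟩

lemma norm_ncpow (a : ℂ) {n : ℕ} (hn : 0 < n) : ‖(n : ℂ) ^ a‖ = (n : ℝ) ^ a.re :=
  Complex.norm_natCast_cpow_of_pos hn a

lemma inv_gammaSeq_tendsto (a : ℂ) :
    Tendsto (fun n : ℕ => poch a (n + 1) / ((n : ℂ) ^ a * (Nat.factorial n : ℂ))) atTop
      (nhds (Complex.Gamma a)⁻¹) := by
  by_cases h : Complex.Gamma a = 0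
  · obtain ⟨m, rfl⟩ := (Complex.Gamma_eq_zero_iff a).1 h
    rw [h, inv_zero]
    refine tendsto_const_nhds.congr' ?_
    filter_upwards [(tendsto_add_atTop_nat 1).eventually (poch_neg_eventually m)] with n hn
    rw [hn]; simp
  · refine ((GammaSeq_tendsto_Gamma a).inv₀ h).congr ?_
    intro n
    rw [gammaSeq_eq, inv_div]

lemma poch_isBigO (a : ℂ) : (fun n : ℕ => poch a (n + 1)) =O[atTop]
    fun n : ℕ => (n : ℝ) ^ a.re * (Nat.factorial n : ℝ) := by
  have h1 := (inv_gammaSeq_tendsto a).isBigO_one ℝ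
  have h2 : (fun n : ℕ => (n : ℂ) ^ a * (Nat.factorial n : ℂ)) =O[atTop]
      fun n : ℕ => (n : ℝ) ^ a.re * (Nat.factorial n : ℝ) := by
    refine Asymptotics.IsBigO.of_bound 1 ?_
    filter_upwards [eventually_gt_atTop 0] with n hn
    rw [norm_mul, norm_ncpow a hn, norm_mul, one_mul]
    simp only [norm_natCast, Real.norm_natCast]
    gcongr
    exact le_abs_self _
  have h3 := h1.mul h2
  simp only [one_mul] at h3
  refine h3.congr' ?_ EventuallyEq.rfl
  filter_upwards [eventually_gt_atTop 0] with n hn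
  have : (n : ℂ) ^ a ≠ 0 := by
    rw [Ne, Complex.cpow_eq_zero_iff]; simp; omega
  have h4 : (Nat.factorial n : ℂ) ≠ 0 := by exact_mod_cast n.factorial_ne_zero
  field_simp

lemma inv_poch_isBigO {c : ℂ} : (fun n : ℕ => (poch c (n + 1))⁻¹) =O[atTop]
    fun n : ℕ => (n : ℝ) ^ (-c.re) * (Nat.factorial n : ℝ)⁻¹ := by
  have h1 := (GammaSeq_tendsto_Gamma c).isBigO_one ℝ
  have h2 : (fun n : ℕ => (n : ℂ) ^ (-c) * (Nat.factorial n : ℂ)⁻¹) =O[atTop]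
      fun n : ℕ => (n : ℝ) ^ (-c.re) * (Nat.factorial n : ℝ)⁻¹ := by
    refine Asymptotics.IsBigO.of_bound 1 ?_
    filter_upwards [eventually_gt_atTop 0] with n hn
    rw [norm_mul, norm_ncpow _ hn, norm_mul, one_mul]
    simp only [norm_natCast, Real.norm_natCast, norm_inv, neg_re]
    gcongr
    exact le_abs_self _
  have h3 := h1.mul h2
  simp only [one_mul] at h3
  refine h3.congr' ?_ EventuallyEq.rfl
  filter_upwards [eventually_gt_atTop 0] with n hn
  have : (n : ℂ) ^ c ≠ 0 := by
    rw [Ne, Complex.cpow_eq_zero_iff]; simp; omega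
  have h4 : (Nat.factorial n : ℂ) ≠ 0 := by exact_mod_cast n.factorial_ne_zero
  rw [gammaSeq_eq, Complex.cpow_neg]
  field_simp

/-- coefficient of the hypergeometric series -/
noncomputable def hC (a b c : ℂ) (k : ℕ) : ℂ :=
  poch a k * poch b k / (poch c k * (Nat.factorial k : ℂ))

lemma hC_isBigO (a b c : ℂ) : (fun n : ℕ => hC a b c (n + 1)) =O[atTop]
    fun n : ℕ => (n : ℝ) ^ (-(c - a - b).re - 1) := by
  have h0 : (fun n : ℕ => ((Nat.factorial (n+1) : ℂ))⁻¹) =O[atTop]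
      fun n : ℕ => (n : ℝ) ^ (-1 : ℝ) * (Nat.factorial n : ℝ)⁻¹ := by
    refine Asymptotics.IsBigO.of_bound 1 ?_
    filter_upwards [eventually_gt_atTop 0] with n hn
    have hn' : (0:ℝ) < n := by exact_mod_cast hn
    rw [Real.rpow_neg_one, one_mul, norm_inv, norm_natCast, ← mul_inv, norm_inv,
      Nat.factorial_succ]
    push_cast
    have : (0:ℝ) < Nat.factorial n := by positivity
    rw [Real.norm_of_nonneg (by positivity)]
    gcongr
    linarith
  have h := (((poch_isBigO a).mul (poch_isBigO b)).mul (inv_poch_isBigO (c := c))).mul h0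
  refine h.congr' (Eventually.of_forall fun n => ?_) ?_
  · simp only [hC, div_eq_mul_inv, mul_inv]; ring
  filter_upwards [eventually_gt_atTop 0] with n hn
  have hn' : (0:ℝ) < n := by exact_mod_cast hn
  have h4 : (Nat.factorial n : ℝ) ≠ 0 := by exact_mod_cast n.factorial_ne_zero
  have : (-(c - a - b).re - 1) = a.re + b.re + (-c.re) + (-1) := by simp; ring
  rw [this, Real.rpow_add hn', Real.rpow_add hn', Real.rpow_add hn']
  field_simp

lemma hC_summable {a b c : ℂ} (h : 0 < (c - a - b).re) : Summable (hC a b c) := by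
  rw [← summable_nat_add_iff 1]
  exact summable_of_isBigO_nat (Real.summable_nat_rpow.2 (by linarith)) (hC_isBigO a b c)

lemma hC_tendsto {a b c : ℂ} (h : 0 < (c - a - b).re) :
    Tendsto (fun k : ℕ => (k : ℂ) * hC a b c k) atTop (nhds 0) := by
  rw [← tendsto_add_atTop_iff_nat 1]
  have h0 : (fun n : ℕ => ((n + 1 : ℕ) : ℂ)) =O[atTop] fun n : ℕ => (n : ℝ) := by
    refine Asymptotics.IsBigO.of_bound 2 ?_
    filter_upwards [eventually_gt_atTop 0] with n hn
    have hn' : (1:ℝ) ≤ n := by exact_mod_cast hn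
    simp only [norm_natCast, Real.norm_natCast]
    push_cast
    linarith
  refine (h0.mul (hC_isBigO a b c)).trans_tendsto ?_
  have h5 : Tendsto (fun n : ℕ => (n : ℝ) ^ (-(c - a - b).re)) atTop (nhds 0) :=
    (tendsto_rpow_neg_atTop h).comp tendsto_natCast_atTop_atTop
  refine h5.congr' ?_
  filter_upwards [eventually_gt_atTop 0] with n hn
  have hn' : (0:ℝ) < n := by exact_mod_cast hn
  rw [Real.rpow_sub_one hn'.ne']
  field_simp

lemma hC_succ (a b c : ℂ) (k : ℕ) (hc : ∀ n : ℕ, c ≠ -(n : ℂ)) :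
    hC a b c (k + 1) * ((c + k) * (k + 1)) = hC a b c k * ((a + k) * (b + k)) := by
  have h1 := poch_ne_zero hc k
  have h2 : c + k ≠ 0 := fun h => hc k (eq_neg_of_add_eq_zero_left h)
  have h4 : (Nat.factorial k : ℂ) ≠ 0 := by exact_mod_cast k.factorial_ne_zero
  have h5 : (k : ℂ) + 1 ≠ 0 := by exact_mod_cast k.succ_ne_zero
  simp only [hC, poch_succ, Nat.factorial_succ]
  push_cast
  field_simp

lemma poch_shift (c : ℂ) (k : ℕ) : c * poch (c + 1) k = poch c k * (c + k) := by
  rw [← poch_succ, poch, poch, Finset.prod_range_succ']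
  push_cast
  rw [mul_comm]
  simp [add_comm, add_left_comm]

lemma hC_shift (a b c : ℂ) (k : ℕ) (hc : ∀ n : ℕ, c ≠ -(n : ℂ)) :
    hC a b (c + 1) k * (c + k) = hC a b c k * c := by
  have h1 := poch_ne_zero hc k
  have h2 : c + k ≠ 0 := fun h => hc k (eq_neg_of_add_eq_zero_left h)
  have h0 : c ≠ 0 := by simpa using hc 0
  have h4 : (Nat.factorial k : ℂ) ≠ 0 := by exact_mod_cast k.factorial_ne_zero
  have h6 : poch (c + 1) k = poch c k * (c + k) / c := by
    rw [← poch_shift]; field_simp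
  simp only [hC, h6]
  field_simp

lemma gauss_contig {a b c : ℂ} (h : 0 < (c - a - b).re) (hc : ∀ n : ℕ, c ≠ -(n : ℂ)) :
    c * (c - a - b) * ∑' k, hC a b c k = (c - a) * (c - b) * ∑' k, hC a b (c + 1) k := by
  have h' : 0 < (c + 1 - a - b).re := by simp at h ⊢; linarith
  have e : ∀ k : ℕ, c * (c - a - b) * hC a b c k - (c - a) * (c - b) * hC a b (c + 1) k
      = c * ((k : ℂ) * hC a b c k) - c * (((k + 1 : ℕ) : ℂ) * hC a b c (k + 1)) := by
    intro k
    have h2 : c + k ≠ 0 := fun h => hc k (eq_neg_of_add_eq_zero_left h)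
    have e1 := hC_succ a b c k hc
    have e2 := hC_shift a b c k hc
    apply mul_right_cancel₀ h2
    push_cast
    linear_combination (-(c - a) * (c - b)) * e2 + c * e1
  have s1 := ((hC_summable h).hasSum.mul_left (c * (c - a - b))).sub
    ((hC_summable h').hasSum.mul_left ((c - a) * (c - b)))
  have s2 : Tendsto (fun n : ℕ => ∑ k ∈ Finset.range n,
      (c * ((k : ℂ) * hC a b c k) - c * (((k + 1 : ℕ) : ℂ) * hC a b c (k + 1)))) atTop
      (nhds 0) := by
    have : ∀ n : ℕ, ∑ k ∈ Finset.range n,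
      (c * ((k : ℂ) * hC a b c k) - c * (((k + 1 : ℕ) : ℂ) * hC a b c (k + 1)))
        = -c * ((n : ℂ) * hC a b c n) := by
      intro n
      rw [Finset.sum_range_sub' (fun k : ℕ => c * ((k : ℂ) * hC a b c k))]
      simp
    simp only [this]
    simpa using (hC_tendsto h).const_mul (-c)
  simp only [e] at s1
  have := tendsto_nhds_unique s1.tendsto_sum_nat s2
  exact sub_eq_zero.1 this

lemma gauss_iter {a b c : ℂ} (h : 0 < (c - a - b).re) (hc : ∀ n : ℕ, c ≠ -(n : ℂ)) (n : ℕ) :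
    poch c n * poch (c - a - b) n * ∑' k, hC a b c k
      = poch (c - a) n * poch (c - b) n * ∑' k, hC a b (c + n) k := by
  induction n with
  | zero => simp [poch_zero]
  | succ n ih =>
    have hc' : ∀ m : ℕ, c + n ≠ -(m : ℂ) := by
      intro m hm
      apply hc (n + m)
      push_cast
      linear_combination hm
    have h' : 0 < (c + n - a - b).re := by
      have : (0:ℝ) ≤ n := n.cast_nonneg
      simp at h ⊢; linarith
    have := gauss_contig h' hc'
    simp only [poch_succ]
    push_cast
    rw [← add_assoc]
    linear_combination (c + n) * (c - a - b + n) * ih + poch (c - a) n * poch (c - b) n * this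

lemma poch_norm_le {c : ℂ} (hc : 0 < c.re) (n k : ℕ) : ‖poch c k‖ ≤ ‖poch (c + n) k‖ := by
  simp only [poch, norm_prod]
  refine Finset.prod_le_prod (fun _ _ => norm_nonneg _) fun i _ => ?_
  rw [Complex.norm_def, Complex.norm_def]
  apply Real.sqrt_le_sqrt
  simp only [Complex.normSq_apply]
  have : (0:ℝ) ≤ n := n.cast_nonneg
  have : (0:ℝ) ≤ i := i.cast_nonneg
  simp
  nlinarith

lemma gauss_limit {a b c : ℂ} (h : 0 < (c - a - b).re) (hc : 0 < c.re) :
    Tendsto (fun n : ℕ => ∑' k, hC a b (c + n) k) atTop (nhds 1) := by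
  have hz : ∑' k : ℕ, (if k = 0 then (1 : ℂ) else 0) = 1 := by simp
  rw [← hz]
  refine tendsto_tsum_of_dominated_convergence (hC_summable h).norm ?_ ?_
  · intro k
    rcases k with _ | k
    · simp [hC, poch_zero]
    · simp only [Nat.add_eq_zero_iff, one_ne_zero, and_false, if_false]
      have hP : Tendsto (fun n : ℕ => (poch (c + n) (k + 1))⁻¹) atTop (nhds 0) := by
        apply tendsto_inv₀_cobounded.comp
        rw [← tendsto_norm_atTop_iff_cobounded]
        have : ∀ n : ℕ, ‖c + n‖ * ‖poch (c + 1) k‖ ≤ ‖poch (c + n) (k + 1)‖ := by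
          intro n
          have := poch_shift (c + n) k
          rw [poch_succ, ← this, norm_mul]
          gcongr
          have := poch_norm_le (c := c + 1) (by simp; linarith) n k
          rwa [add_right_comm] at this
        refine tendsto_atTop_mono this ?_
        refine Tendsto.atTop_mul_const ?_ ?_
        · exact norm_pos_iff.2 (poch_ne_zero (ne_neg_of_re_pos (by simp; linarith)) k)
        · refine tendsto_atTop_mono (f := fun n : ℕ => (n : ℝ)) (fun n => ?_)
            tendsto_natCast_atTop_atTop
          refine le_trans ?_ (Complex.re_le_norm _)
          simp; linarith
      have := hP.const_mul (poch a (k+1) * poch b (k+1) * ((Nat.factorial (k+1) : ℂ))⁻¹)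
      rw [mul_zero] at this
      refine this.congr fun n => ?_
      simp only [hC, div_eq_mul_inv, mul_inv]; ring
  · refine Eventually.of_forall fun n k => ?_
    simp only [hC, norm_div, norm_mul]
    have h0 : 0 < ‖poch c k‖ := norm_pos_iff.2 (poch_ne_zero (ne_neg_of_re_pos hc) k)
    have h4 : 0 < ‖(Nat.factorial k : ℂ)‖ := by
      rw [norm_natCast]; positivity
    gcongr
    exact poch_norm_le hc n k

lemma gauss_sum {a b c : ℂ} (h : 0 < (c - a - b).re) (hc : 0 < c.re) :
    ∑' k, hC a b c k = Complex.Gamma c * Complex.Gamma (c - a - b) /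
      (Complex.Gamma (c - a) * Complex.Gamma (c - b)) := by
  have hc' := ne_neg_of_re_pos hc
  have hd' := ne_neg_of_re_pos h
  have l1 := (inv_gammaSeq_tendsto c).mul (inv_gammaSeq_tendsto (c - a - b))
  have l2 := ((inv_gammaSeq_tendsto (c - a)).mul (inv_gammaSeq_tendsto (c - b))).mul
    ((gauss_limit h hc).comp (tendsto_add_atTop_nat 1))
  have l3 := l1.mul_const (∑' k, hC a b c k)
  have := tendsto_nhds_unique (l3.congr' ?_) l2
  · have g1 := Complex.Gamma_ne_zero hc'
    have g2 := Complex.Gamma_ne_zero hd'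
    rw [mul_one, ← mul_inv, ← mul_inv] at this
    rw [div_eq_mul_inv, ← this]
    field_simp
  · filter_upwards [eventually_gt_atTop 0] with n hn
    have e := gauss_iter h hc' (n + 1)
    have hn0 : (n : ℂ) ≠ 0 := by exact_mod_cast hn.ne'
    have hp : (n : ℂ) ^ c * (n : ℂ) ^ (c - a - b) = (n : ℂ) ^ (c - a) * (n : ℂ) ^ (c - b) := by
      rw [← Complex.cpow_add _ _ hn0, ← Complex.cpow_add _ _ hn0]; ring_nf
    have hq : (((n : ℂ) ^ c * (Nat.factorial n : ℂ)) * ((n : ℂ) ^ (c - a - b) * (Nat.factorial n : ℂ)))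
       = (((n : ℂ) ^ (c - a) * (Nat.factorial n : ℂ)) * ((n : ℂ) ^ (c - b) * (Nat.factorial n : ℂ))) := by
      linear_combination (Nat.factorial n : ℂ) ^ 2 * hp
    simp only [Function.comp]
    rw [div_mul_div_comm, div_mul_div_comm, hq, div_mul_eq_mul_div, div_mul_eq_mul_div, e]
lemma hk_summable (α β C : ℂ) {z : ℂ} (hz : ‖z‖ < 1) : Summable fun k => hC α β C k * z ^ k := by
  rw [← summable_nat_add_iff 1]
  set r : ℝ := -(C - α - β).re - 1 with hr
  have h0 : (fun n : ℕ => z ^ (n + 1)) =O[atTop] fun n : ℕ => ‖z‖ ^ n := by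
    refine Asymptotics.IsBigO.of_bound 1 (Eventually.of_forall fun n => ?_)
    rw [norm_pow, norm_pow, norm_norm, one_mul]
    exact pow_le_pow_of_le_one (norm_nonneg _) hz.le (Nat.le_succ n)
  have h1 : (fun n : ℕ => (n : ℝ) ^ r) =O[atTop] fun n : ℕ => ((n : ℝ) ^ ⌈r⌉₊) := by
    refine Asymptotics.IsBigO.of_bound 1 ?_
    filter_upwards [eventually_gt_atTop 0] with n hn
    have hn' : (1:ℝ) ≤ n := by exact_mod_cast hn
    rw [one_mul, Real.norm_of_nonneg (by positivity), Real.norm_of_nonneg (by positivity),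
      ← Real.rpow_natCast]
    exact Real.rpow_le_rpow_of_exponent_le hn' (Nat.le_ceil r)
  refine summable_of_isBigO_nat ?_ (((hC_isBigO α β C).trans h1).mul h0)
  exact summable_pow_mul_geometric_of_norm_lt_one _ (by simpa using hz)

lemma poch_eq_asc (m : ℂ) (n : ℕ) : poch m n = (ascPochhammer ℂ n).eval m := by
  induction n with
  | zero => simp [poch_zero]
  | succ n ih => rw [poch_succ, ascPochhammer_succ_eval, ih]

lemma binom_hasSum (m : ℂ) {z : ℂ} (hz : ‖z‖ < 1) :
    HasSum (fun j : ℕ => poch m j / (Nat.factorial j : ℂ) * z ^ j) ((1 - z) ^ (-m)) := by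
  have h := (Complex.one_div_one_sub_cpow_hasFPowerSeriesOnBall_zero m).hasSum (y := z)
    (by rw [← ENNReal.ofReal_one, Metric.eball_ofReal]; simpa using hz)
  simp only [zero_add, FormalMultilinearSeries.ofScalars_apply_eq, smul_eq_mul] at h
  rw [Complex.cpow_neg, ← one_div]
  convert h using 2 with j
  congr 1
  have e := Ring.factorial_nsmul_multichoose_eq_ascPochhammer m j
  rw [Ring.multichoose_eq, Polynomial.ascPochhammer_smeval_eq_eval, ← poch_eq_asc] at e
  rw [← e, nsmul_eq_mul]
  have h4 : (Nat.factorial j : ℂ) ≠ 0 := by exact_mod_cast j.factorial_ne_zero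
  field_simp

lemma gamma_add_nat {z : ℂ} (hz : ∀ n : ℕ, z ≠ -(n : ℂ)) (k : ℕ) :
    Complex.Gamma (z + k) = poch z k * Complex.Gamma z := by
  induction k with
  | zero => simp [poch_zero]
  | succ k ih =>
    have h2 : z + k ≠ 0 := fun h => hz k (eq_neg_of_add_eq_zero_left h)
    push_cast
    rw [← add_assoc, Complex.Gamma_add_one _ h2, ih, poch_succ]; ring

lemma integral_inv_Ioi (g : ℝ → ℂ) :
    ∫ y in Ioi (1:ℝ), g y = ∫ v in Ioo (0:ℝ) 1, ((v ^ 2)⁻¹ : ℝ) • g v⁻¹ := by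
  have him : (fun v : ℝ => v⁻¹) '' Ioo (0:ℝ) 1 = Ioi 1 := by
    ext y
    simp only [mem_image, mem_Ioo, mem_Ioi]
    constructor
    · rintro ⟨v, ⟨h0, h1⟩, rfl⟩
      exact (one_lt_inv₀ h0).2 h1
    · intro hy
      exact ⟨y⁻¹, ⟨by positivity, inv_lt_one_of_one_lt₀ hy⟩, inv_inv y⟩
  rw [← him, integral_image_eq_integral_abs_deriv_smul (f' := fun v => -(v ^ 2)⁻¹)
    measurableSet_Ioo ?_ (inv_injective.injOn)]
  · simp
  · intro v hv
    exact (hasDerivAt_inv hv.1.ne').hasDerivWithinAt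

lemma beta_Ioo {p q : ℂ} (hp : 0 < p.re) (hq : 0 < q.re) :
    IntegrableOn (fun v : ℝ => (v : ℂ) ^ (p - 1) * (1 - (v : ℂ)) ^ (q - 1)) (Ioo 0 1) ∧
    ∫ v in Ioo (0:ℝ) 1, (v : ℂ) ^ (p - 1) * (1 - (v : ℂ)) ^ (q - 1)
      = Complex.Gamma p * Complex.Gamma q / Complex.Gamma (p + q) := by
  constructor
  · have := Complex.betaIntegral_convergent hp hq
    rw [intervalIntegrable_iff_integrableOn_Ioo_of_le zero_le_one] at this
    exact this
  · have := Complex.betaIntegral_eq_Gamma_mul_div p q hp hq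
    rw [← this, Complex.betaIntegral, intervalIntegral.integral_of_le zero_le_one,
      integral_Ioc_eq_integral_Ioo]

lemma norm_beta_Ioo {p q : ℂ} (hp : 0 < p.re) (hq : 0 < q.re) :
    ∫ v in Ioo (0:ℝ) 1, ‖(v : ℂ) ^ (p - 1) * (1 - (v : ℂ)) ^ (q - 1)‖
      = ‖Complex.Gamma (p.re : ℂ) * Complex.Gamma (q.re : ℂ) /
          Complex.Gamma ((p.re : ℂ) + (q.re : ℂ))‖ := by
  have h0 : 0 ≤ ∫ v in Ioo (0:ℝ) 1, ‖(v : ℂ) ^ (p - 1) * (1 - (v : ℂ)) ^ (q - 1)‖ :=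
    integral_nonneg fun _ => norm_nonneg _
  rw [← (beta_Ioo (p := (p.re : ℂ)) (q := (q.re : ℂ)) (by simpa) (by simpa)).2,
    ← Real.norm_of_nonneg h0, ← Complex.norm_real, ← integral_complex_ofReal]
  congr 1
  refine setIntegral_congr_fun measurableSet_Ioo fun v hv => ?_
  have h1 : (0:ℝ) < 1 - v := by linarith [hv.2]
  have e : (1 - (v : ℂ)) = ((1 - v : ℝ) : ℂ) := by push_cast; rfl
  simp only [e]
  rw [norm_mul, Complex.norm_cpow_eq_rpow_re_of_pos hv.1, Complex.norm_cpow_eq_rpow_re_of_pos h1]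
  push_cast [Complex.ofReal_cpow hv.1.le, Complex.ofReal_cpow h1.le]
  simp

lemma poch_re_le {C : ℂ} (hC : 0 < C.re) (k : ℕ) : ‖poch (C.re : ℂ) k‖ ≤ ‖poch C k‖ := by
  simp only [poch, norm_prod]
  refine Finset.prod_le_prod (fun _ _ => norm_nonneg _) fun i _ => ?_
  have h0 : (0:ℝ) ≤ i := i.cast_nonneg
  have : ((C.re : ℂ) + i) = ((C.re + i : ℝ) : ℂ) := by push_cast; rfl
  rw [this, Complex.norm_real, Real.norm_of_nonneg (by linarith)]
  have := Complex.re_le_norm (C + i)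
  simpa using this

lemma summable_k {α β B C : ℂ} (hB : 0 < B.re) (hC0 : 0 < C.re)
    (h : 0 < (B + C - α - β).re) :
    Summable fun k : ℕ => ‖hC α β C k‖ *
      ∫ v in Ioo (0:ℝ) 1, ‖(v : ℂ) ^ (B - 1) * (1 - (v : ℂ)) ^ (C + k - 1)‖ := by
  have hs := (hC_summable (a := α) (b := β) (c := (B.re : ℂ) + C.re)
    (by simpa using h)).norm.mul_left
      ‖Complex.Gamma (B.re : ℂ) * Complex.Gamma (C.re : ℂ) / Complex.Gamma ((B.re : ℂ) + C.re)‖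
  refine Summable.of_nonneg_of_le (fun k => ?_) (fun k => ?_) hs
  · exact mul_nonneg (norm_nonneg _) (integral_nonneg fun _ => norm_nonneg _)
  · have hk : (0:ℝ) ≤ k := k.cast_nonneg
    rw [norm_beta_Ioo hB (by simp; linarith)]
    have e1 : (((C + k).re : ℝ) : ℂ) = (C.re : ℂ) + k := by simp
    have e2 : Complex.Gamma ((C.re : ℂ) + k) = poch (C.re : ℂ) k * Complex.Gamma (C.re : ℂ) :=
      gamma_add_nat (ne_neg_of_re_pos (by simpa)) k
    have e3 : Complex.Gamma ((B.re : ℂ) + C.re + k)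
        = poch ((B.re : ℂ) + C.re) k * Complex.Gamma ((B.re : ℂ) + C.re) :=
      gamma_add_nat (ne_neg_of_re_pos (by simp; linarith)) k
    rw [e1, ← add_assoc, e2, e3]
    simp only [hC, norm_mul, norm_div]
    have p1 : 0 < ‖poch C k‖ := norm_pos_iff.2 (poch_ne_zero (ne_neg_of_re_pos hC0) k)
    have p2 : 0 < ‖poch ((B.re : ℂ) + C.re) k‖ :=
      norm_pos_iff.2 (poch_ne_zero (ne_neg_of_re_pos (by simp; linarith)) k)
    have p3 : 0 < ‖Complex.Gamma ((B.re : ℂ) + C.re)‖ :=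
      norm_pos_iff.2 (Complex.Gamma_ne_zero_of_re_pos (by simp; linarith))
    have p4 : 0 < ‖(Nat.factorial k : ℂ)‖ := by rw [norm_natCast]; positivity
    have p5 := poch_re_le hC0 k
    calc _ = (‖poch α k‖ * ‖poch β k‖ * ‖Complex.Gamma (B.re : ℂ)‖ * ‖Complex.Gamma (C.re : ℂ)‖ /
            (‖(Nat.factorial k : ℂ)‖ * ‖poch ((B.re : ℂ) + C.re) k‖ *
              ‖Complex.Gamma ((B.re : ℂ) + C.re)‖)) * (‖poch (C.re : ℂ) k‖ / ‖poch C k‖) := by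
          field_simp
      _ ≤ (‖poch α k‖ * ‖poch β k‖ * ‖Complex.Gamma (B.re : ℂ)‖ * ‖Complex.Gamma (C.re : ℂ)‖ /
            (‖(Nat.factorial k : ℂ)‖ * ‖poch ((B.re : ℂ) + C.re) k‖ *
              ‖Complex.Gamma ((B.re : ℂ) + C.re)‖)) * 1 := by
          gcongr
          exact (div_le_one p1).2 p5
      _ = _ := by field_simp

lemma double_sum {α β B C m : ℂ} (hB : 0 < B.re) (hC0 : 0 < C.re)
    (h : 0 < (B + C - α - β).re) {x : ℝ} (hx0 : 0 < x) (hx1 : x < 1) :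
    ∫ v in Ioo (0:ℝ) 1, (v : ℂ) ^ (B - 1) * (1 - (v : ℂ)) ^ (C - 1) *
        ((1 - (x : ℂ) * v) ^ (-m) * ∑' k, hC α β C k * (1 - (v : ℂ)) ^ k)
      = ∑' j : ℕ, poch m j / (Nat.factorial j : ℂ) * (x : ℂ) ^ j *
          (Complex.Gamma (B + j) * Complex.Gamma C / Complex.Gamma (B + C + j) *
            ∑' k, hC α β (B + C + j) k) := by
  set s : ℕ → ℂ := fun j => poch m j / (Nat.factorial j : ℂ) * (x : ℂ) ^ j with hs
  have ssum : Summable s := (binom_hasSum m (z := (x : ℂ))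
    (by rw [Complex.norm_real, Real.norm_of_nonneg hx0.le]; exact hx1)).summable
  let F : ℕ × ℕ → ℝ → ℂ := fun p v =>
    (s p.1 * hC α β C p.2) * ((v : ℂ) ^ (B + p.1 - 1) * (1 - (v : ℂ)) ^ (C + p.2 - 1))
  have hBj : ∀ j : ℕ, 0 < (B + j).re := fun j => by
    have hk : (0:ℝ) ≤ j := j.cast_nonneg
    simp; linarith
  have hCj : ∀ j : ℕ, 0 < (C + j).re := fun j => by
    have hk : (0:ℝ) ≤ j := j.cast_nonneg
    simp; linarith
  have Fint : ∀ p, Integrable (F p) (volume.restrict (Ioo (0:ℝ) 1)) := fun p =>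
    (beta_Ioo (hBj p.1) (hCj p.2)).1.const_mul _
  have Fsum : Summable fun p => ∫ v in Ioo (0:ℝ) 1, ‖F p v‖ := by
    have hprod := ssum.norm.mul_of_nonneg (summable_k hB hC0 h) (fun _ => norm_nonneg _)
      (fun k => mul_nonneg (norm_nonneg _) (integral_nonneg fun _ => norm_nonneg _))
    refine Summable.of_nonneg_of_le (fun p => integral_nonneg fun v => norm_nonneg (F p v))
      (fun p => ?_) hprod
    rw [← mul_assoc, ← integral_const_mul]
    refine setIntegral_mono_on (Fint p).norm
      ((beta_Ioo hB (hCj p.2)).1.norm.const_mul _) measurableSet_Ioo fun v hv => ?_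
    simp only [F, norm_mul]
    have hv0 : (v : ℂ) ≠ 0 := by exact_mod_cast hv.1.ne'
    have e : (v : ℂ) ^ (B + p.1 - 1) = (v : ℂ) ^ (B - 1) * (v : ℂ) ^ p.1 := by
      rw [add_sub_right_comm, Complex.cpow_add _ _ hv0, Complex.cpow_natCast]
    rw [e]
    have hle : ‖(v : ℂ) ^ p.1‖ ≤ 1 := by
      rw [norm_pow, Complex.norm_real, Real.norm_of_nonneg hv.1.le]
      exact pow_le_one₀ hv.1.le hv.2.le
    have := mul_le_of_le_one_right (norm_nonneg ((v : ℂ) ^ (B - 1))) hle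
    rw [← norm_mul] at this
    gcongr
  have key := hasSum_integral_of_summable_integral_norm Fint Fsum
  have e1 : ∫ v in Ioo (0:ℝ) 1, (v : ℂ) ^ (B - 1) * (1 - (v : ℂ)) ^ (C - 1) *
        ((1 - (x : ℂ) * v) ^ (-m) * ∑' k, hC α β C k * (1 - (v : ℂ)) ^ k)
      = ∫ v in Ioo (0:ℝ) 1, ∑' p, F p v := by
    refine setIntegral_congr_fun measurableSet_Ioo fun v hv => ?_
    have hv0 : (v : ℂ) ≠ 0 := by exact_mod_cast hv.1.ne'
    have hv1 : (1 - (v : ℂ)) ≠ 0 := by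
      rw [sub_ne_zero]; exact_mod_cast hv.2.ne'
    have hz : ‖(x : ℂ) * v‖ < 1 := by
      rw [← Complex.ofReal_mul, Complex.norm_real, Real.norm_of_nonneg (by nlinarith [hv.1])]
      nlinarith [hv.1, hv.2]
    have b := binom_hasSum m hz
    have hk : Summable fun k => hC α β C k * (1 - (v : ℂ)) ^ k := by
      have hn : ‖(1 - (v : ℂ))‖ < 1 := by
        rw [← Complex.ofReal_one, ← Complex.ofReal_sub, Complex.norm_real,
          Real.norm_of_nonneg (by linarith [hv.2])]
        linarith [hv.1]
      exact hk_summable α β C hn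
    rw [← b.tsum_eq, tsum_mul_tsum_of_summable_norm b.summable.norm hk.norm, ← tsum_mul_left]
    refine tsum_congr fun p => ?_
    simp only [F, hs]
    rw [add_sub_right_comm, Complex.cpow_add _ _ hv0, Complex.cpow_natCast,
      add_sub_right_comm, Complex.cpow_add _ _ hv1, Complex.cpow_natCast]
    ring
  rw [e1, ← key.tsum_eq, key.summable.tsum_prod]
  refine tsum_congr fun j => ?_
  rw [← tsum_mul_left, ← tsum_mul_left]
  refine tsum_congr fun k => ?_
  simp only [F]
  rw [integral_const_mul, (beta_Ioo (hBj j) (hCj k)).2]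
  have hBC : 0 < (B + C + j).re := by
    have := hBj j
    simp at this ⊢; linarith
  rw [gamma_add_nat (ne_neg_of_re_pos hC0), show B + j + (C + k) = (B + C + j) + k by ring,
    gamma_add_nat (ne_neg_of_re_pos hBC)]
  have p1 := poch_ne_zero (ne_neg_of_re_pos hC0) k
  have p2 := poch_ne_zero (ne_neg_of_re_pos hBC) k
  have p3 := Complex.Gamma_ne_zero_of_re_pos hBC
  have h4 : (Nat.factorial k : ℂ) ≠ 0 := by exact_mod_cast k.factorial_ne_zero
  simp only [hC, hs]
  field_simp

lemma inv_real_cpow {v : ℝ} (hv : 0 < v) (s : ℂ) : ((v⁻¹ : ℝ) : ℂ) ^ s = (v : ℂ) ^ (-s) := by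
  rw [Complex.ofReal_inv, Complex.inv_cpow _ _ ?_, Complex.cpow_neg]
  rw [Complex.arg_ofReal_of_nonneg hv.le]
  exact Real.pi_pos.ne

lemma integrand_eq (a b c μ : ℂ) {x v : ℝ} (hx0 : 0 < x) (hx1 : x < 1) (hv0 : 0 < v)
    (hv1 : v < 1) :
    ((v ^ 2)⁻¹ : ℝ) • (((v⁻¹ : ℝ) : ℂ) ^ (c - 1) * ((v⁻¹ - 1 : ℝ) : ℂ) ^ (c - a - b) *
          hypF (c - a) (c - b) (c - a - b + 1) (1 - v⁻¹) * ((v⁻¹ - x : ℝ) : ℂ) ^ (μ - 1))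
      = (v : ℂ) ^ ((b - c - μ + 1) - 1) * (1 - (v : ℂ)) ^ ((c - a - b + 1) - 1) *
        ((1 - (x : ℂ) * v) ^ (-(1 - μ)) *
          ∑' k, hC (c - a) (c - a - b + 1 - (c - b)) (c - a - b + 1) k * (1 - (v : ℂ)) ^ k) := by
  have hvi : 1 < v⁻¹ := (one_lt_inv₀ hv0).2 hv1
  have hvc : (v : ℂ) ≠ 0 := by exact_mod_cast hv0.ne'
  have hF : hypF (c - a) (c - b) (c - a - b + 1) (1 - v⁻¹) = (v : ℂ) ^ (c - a) *
      ∑' k, hC (c - a) (c - a - b + 1 - (c - b)) (c - a - b + 1) k * (1 - (v : ℂ)) ^ k := by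
    rw [hypF, if_neg (by linarith)]
    have e1 : (1 - (1 - v⁻¹) : ℝ) = v⁻¹ := by ring
    have e2 : (1 - v⁻¹) / (1 - v⁻¹ - 1) = 1 - v := by
      field_simp
      ring
    rw [e1, e2, inv_real_cpow hv0, neg_neg]
    simp only [hC, Complex.ofReal_sub, Complex.ofReal_one]
  have e3 : ((v⁻¹ - 1 : ℝ) : ℂ) ^ (c - a - b)
      = (1 - (v : ℂ)) ^ (c - a - b) * (v : ℂ) ^ (-(c - a - b)) := by
    have : v⁻¹ - 1 = (1 - v) * v⁻¹ := by field_simp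
    rw [this, Complex.ofReal_mul, Complex.mul_cpow_ofReal_nonneg (by linarith) (by positivity),
      inv_real_cpow hv0]
    simp
  have e4 : ((v⁻¹ - x : ℝ) : ℂ) ^ (μ - 1)
      = (1 - (x : ℂ) * v) ^ (μ - 1) * (v : ℂ) ^ (-(μ - 1)) := by
    have : v⁻¹ - x = (1 - x * v) * v⁻¹ := by field_simp
    rw [this, Complex.ofReal_mul, Complex.mul_cpow_ofReal_nonneg (by nlinarith) (by positivity),
      inv_real_cpow hv0]
    simp
  have e5 : (((v ^ 2)⁻¹ : ℝ) : ℂ) = (v : ℂ) ^ (-2 : ℂ) := by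
    rw [Complex.cpow_neg]
    norm_cast
  rw [hF, e3, e4, inv_real_cpow hv0, Complex.real_smul, e5]
  have e6 : (v : ℂ) ^ (b - c - μ + 1 - 1) = (v : ℂ) ^ (-2 : ℂ) * (v : ℂ) ^ (-(c - 1)) *
      (v : ℂ) ^ (-(c - a - b)) * (v : ℂ) ^ (c - a) * (v : ℂ) ^ (-(μ - 1)) := by
    rw [← Complex.cpow_add _ _ hvc, ← Complex.cpow_add _ _ hvc, ← Complex.cpow_add _ _ hvc,
      ← Complex.cpow_add _ _ hvc]
    congr 1
    ring
  rw [e6, show -(1 - μ) = μ - 1 by ring, show c - a - b + 1 - 1 = c - a - b by ring]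
  ring

lemma poch_div_gamma (m : ℂ) (j : ℕ) :
    poch m j / Complex.Gamma (m + j) = (Complex.Gamma m)⁻¹ := by
  by_cases hm : ∀ n : ℕ, m ≠ -(n : ℂ)
  · rw [gamma_add_nat hm]
    have := poch_ne_zero hm j
    have := Complex.Gamma_ne_zero hm
    field_simp
  · push Not at hm
    obtain ⟨n, rfl⟩ := hm
    rw [(Complex.Gamma_eq_zero_iff (-(n : ℂ))).2 ⟨n, rfl⟩, inv_zero]
    rcases le_or_gt j n with h | h
    · have : Complex.Gamma (-(n : ℂ) + j) = 0 :=
        (Complex.Gamma_eq_zero_iff _).2 ⟨n - j, by push_cast [Nat.cast_sub h]; ring⟩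
      rw [this, div_zero]
    · have : poch (-(n : ℂ)) j = 0 := by
        rw [poch, Finset.prod_eq_zero_iff]
        exact ⟨n, Finset.mem_range.2 h, by simp⟩
      rw [this, zero_div]

lemma stieltjes_main (a b c μ : ℂ)
    (ha : 0 < (a - c - μ + 1).re) (hb : 0 < (b - c - μ + 1).re)
    (hab : 0 < (c - a - b + 1).re) (h2 : ∀ n : ℕ, 2 - c - μ ≠ -(n : ℂ))
    (x : ℝ) (hx0 : 0 < x) (hx1 : x < 1) :
    (∫ y in Ioi (1:ℝ),
        (y : ℂ) ^ (c - 1) * ((y - 1 : ℝ) : ℂ) ^ (c - a - b) *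
          hypF (c - a) (c - b) (c - a - b + 1) (1 - y) * ((y - x : ℝ) : ℂ) ^ (μ - 1))
      = Complex.Gamma (a - c - μ + 1) * Complex.Gamma (b - c - μ + 1) *
          Complex.Gamma (c - a - b + 1) /
          (Complex.Gamma (2 - c - μ) * Complex.Gamma (1 - μ)) *
        hypF (a - c - μ + 1) (b - c - μ + 1) (2 - c - μ) x := by
  rw [integral_inv_Ioi, setIntegral_congr_fun measurableSet_Ioo
    (fun v hv => integrand_eq a b c μ hx0 hx1 hv.1 hv.2),
    double_sum hb hab (by ring_nf at ha ⊢; exact ha) hx0 hx1, hypF, if_pos hx0.le, ← tsum_mul_left]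
  refine tsum_congr fun j => ?_
  have hj : (0:ℝ) ≤ j := j.cast_nonneg
  have hBC : 0 < (b - c - μ + 1 + (c - a - b + 1) + j).re := by
    simp at hb hab ⊢; linarith
  rw [gauss_sum (by simp at ha ⊢; linarith) hBC]
  rw [show b - c - μ + 1 + (c - a - b + 1) + j - (c - a) - (c - a - b + 1 - (c - b))
      = a - c - μ + 1 + j by ring,
    show b - c - μ + 1 + (c - a - b + 1) + j - (c - a) = 2 - c - μ + j by ring,
    show b - c - μ + 1 + (c - a - b + 1) + j - (c - a - b + 1 - (c - b)) = 1 - μ + j by ring,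
    gamma_add_nat (ne_neg_of_re_pos ha), gamma_add_nat (ne_neg_of_re_pos hb), gamma_add_nat h2]
  have p1 := Complex.Gamma_ne_zero_of_re_pos hBC
  have p2 := Complex.Gamma_ne_zero h2
  have p3 := poch_ne_zero h2 j
  have h4 : (Nat.factorial j : ℂ) ≠ 0 := by exact_mod_cast j.factorial_ne_zero
  have key := poch_div_gamma (1 - μ) j
  have e : ∀ z : ℂ, z / (Complex.Gamma (2 - c - μ) * Complex.Gamma (1 - μ))
      = z / Complex.Gamma (2 - c - μ) * (poch (1 - μ) j / Complex.Gamma (1 - μ + j)) := by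
    intro z
    rw [key, div_mul_eq_div_div, div_eq_mul_inv (z / _)]
  rw [e]
  field_simp

/-- Generalized Stieltjes transform of type `c+` sending the solution `w₆` to the
solution `w₂` of the hypergeometric differential equation. -/
theorem stmt_14 (a b c μ : ℂ)
    (ha : 0 < (a - c - μ + 1).re) (hb : 0 < (b - c - μ + 1).re)
    (hab : 0 < (c - a - b + 1).re)
    (h1 : ∀ n : ℕ, c - a - b + 1 ≠ -(n : ℂ)) (h2 : ∀ n : ℕ, 2 - c - μ ≠ -(n : ℂ))
    (x : ℝ) (hx0 : 0 < x) (hx1 : x < 1) :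
    (∫ y in Ioi (1:ℝ),
        (y : ℂ) ^ (c - 1) * ((y - 1 : ℝ) : ℂ) ^ (c - a - b) *
          hypF (c - a) (c - b) (c - a - b + 1) (1 - y) * ((y - x : ℝ) : ℂ) ^ (μ - 1))
      = Complex.Gamma (a - c - μ + 1) * Complex.Gamma (b - c - μ + 1) *
          Complex.Gamma (c - a - b + 1) /
          (Complex.Gamma (2 - c - μ) * Complex.Gamma (1 - μ)) *
        (x : ℂ) ^ (c + μ - 1) *
        ((x : ℂ) ^ (1 - c - μ) * hypF (a - c - μ + 1) (b - c - μ + 1) (2 - c - μ) x)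
    ∧
    (∫ y in Ioi (1:ℝ),
        (y : ℂ) ^ (c - 1) * ((y - 1 : ℝ) : ℂ) ^ (c - a - b) *
          hypF (c - a) (c - b) (c - a - b + 1) (1 - y) * ((y - x : ℝ) : ℂ) ^ (μ - 1))
      = Complex.Gamma (a - c - μ + 1) * Complex.Gamma (b - c - μ + 1) *
          Complex.Gamma (c - a - b + 1) /
          (Complex.Gamma (2 - c - μ) * Complex.Gamma (1 - μ)) *
        hypF (a - c - μ + 1) (b - c - μ + 1) (2 - c - μ) x := by
  have key := stieltjes_main a b c μ ha hb hab h2 x hx0 hx1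
  refine ⟨?_, key⟩
  rw [key, mul_assoc _ ((x : ℂ) ^ (c + μ - 1)), ← mul_assoc ((x : ℂ) ^ (c + μ - 1)),
    ← Complex.cpow_add _ _ (by exact_mod_cast hx0.ne'),
    show c + μ - 1 + (1 - c - μ) = 0 by ring, Complex.cpow_zero, one_mul]
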